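/- arXiv:2209.00013 — 2 statements merged into one kernel-verified Lean document; each statement's English description precedes it below -/
import Mathlib

section
/- Let d = 3, L = 1, V(φ) = −(9/16)φ² + 9φ³ + 11φ⁴, Δ = 3/2 + 3/(2√2), r₀ = 2.5, and ω₀ = r₀ + r₀³. Define φ(r) = (3.8/r)^Δ · [ −1 + (3.2/r)² − (2.4/r)⁴ ] for r ≥ r₀, h(r) = (1/2) ∫_{r₀}^{r} ρ·φ′(ρ)² dρ, χ(r) = (1 + r²)·φ′(r)² + 2V(φ(r)), and ω(r) = e^{−h(r)} [ ω₀ + (1/2) ∫_{r₀}^{r} e^{h(ρ)} ρ² χ(ρ) dρ ]. Then the limit ω_∞ = lim_{r→∞} ω(r) exists and satisfies ω_∞ < r₀ + r₀³. -/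
open Filter

lemma penrose_core (a ω₀ : ℝ) (f K k h ω : ℝ → ℝ)
    (f0 : ∀ r > a, 0 ≤ f r) (K0 : ∀ r > a, 0 ≤ K r) (k0 : ∀ r > a, 0 ≤ k r)
    (fi : MeasureTheory.IntegrableOn f (Set.Ioi a)) (Ki : MeasureTheory.IntegrableOn K (Set.Ioi a))
    (ki : MeasureTheory.IntegrableOn k (Set.Ioi a))
    (hh : ∀ r ≥ a, h r = ∫ ρ in a..r, f ρ)
    (hω : ∀ r ≥ a, ω r = Real.exp (-h r) *
      (ω₀ + ∫ ρ in a..r, Real.exp (h ρ) * (K ρ - k ρ))) :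
    ∃ L : ℝ, Tendsto ω atTop (nhds L) ∧
      L ≤ Real.exp (-∫ r in Set.Ioi a, f r) * (ω₀ - ∫ r in Set.Ioi a, k r)
        + ∫ r in Set.Ioi a, K r := by
  set H := ∫ r in Set.Ioi a, f r with hH
  have hs : ∀ r ≥ a, h r = ∫ ρ in Set.Ioc a r, f ρ := fun r hr => by
    rw [hh r hr, intervalIntegral.integral_of_le hr]
  have hnn : ∀ r ≥ a, 0 ≤ h r := fun r hr => by
    rw [hs r hr]
    exact MeasureTheory.setIntegral_nonneg measurableSet_Ioc fun x hx => f0 x hx.1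
  have f0ae : 0 ≤ᵐ[MeasureTheory.volume.restrict (Set.Ioi a)] f := by
    filter_upwards [MeasureTheory.ae_restrict_mem measurableSet_Ioi] with x hx using f0 x hx
  have hle : ∀ r ≥ a, h r ≤ H := fun r hr => by
    rw [hs r hr]
    exact MeasureTheory.setIntegral_mono_set fi f0ae
      (LE.le.eventuallyLE (fun x hx => hx.1))
  have hmono : MonotoneOn h (Set.Ioi a) := by
    intro x hx y hy hxy
    rw [hs x (le_of_lt hx), hs y (le_of_lt hy)]
    refine MeasureTheory.setIntegral_mono_set (fi.mono_set fun z hz => hz.1) ?_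
      (LE.le.eventuallyLE (Set.Ioc_subset_Ioc_right hxy))
    filter_upwards [MeasureTheory.ae_restrict_mem measurableSet_Ioc] with x hx using f0 x hx.1
  have hm : AEMeasurable h (MeasureTheory.volume.restrict (Set.Ioi a)) :=
    aemeasurable_restrict_of_monotoneOn measurableSet_Ioi hmono
  have hi : ∀ g : ℝ → ℝ, MeasureTheory.IntegrableOn g (Set.Ioi a) →
      MeasureTheory.IntegrableOn (fun r => Real.exp (h r) * g r) (Set.Ioi a) := by
    intro g hg
    refine MeasureTheory.Integrable.bdd_mul (c := Real.exp H) hg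
      (Real.measurable_exp.comp_aemeasurable hm).aestronglyMeasurable ?_
    filter_upwards [MeasureTheory.ae_restrict_mem measurableSet_Ioi] with x hx
    rw [Real.norm_eq_abs, abs_of_pos (Real.exp_pos _)]
    exact Real.exp_le_exp.2 (hle x (le_of_lt hx))
  have hKk := hi _ (Ki.sub ki)
  have t1 : Tendsto h atTop (nhds H) := by
    refine (MeasureTheory.intervalIntegral_tendsto_integral_Ioi a fi tendsto_id).congr' ?_
    filter_upwards [eventually_ge_atTop a] with r hr using (hh r hr).symm
  have t2 := MeasureTheory.intervalIntegral_tendsto_integral_Ioi a hKk tendsto_id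
  refine ⟨_, ((Real.continuous_exp.tendsto _).comp t1.neg |>.mul (t2.const_add ω₀)).congr' ?_, ?_⟩
  · filter_upwards [eventually_ge_atTop a] with r hr
    rw [hω r hr]; rfl
  · have h1 : ∫ r in Set.Ioi a, Real.exp (h r) * (K - k) r ≤
        ∫ r in Set.Ioi a, (Real.exp H * K r - k r) := by
      refine MeasureTheory.setIntegral_mono_on hKk ((Ki.const_mul _).sub ki) measurableSet_Ioi ?_
      intro x hx
      have e1 := Real.exp_le_exp.2 (hle x (le_of_lt hx))
      have e2 := Real.one_le_exp (hnn x (le_of_lt hx))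
      have e3 := K0 x hx
      have e4 := k0 x hx
      simp only [Pi.sub_apply]
      nlinarith
    rw [MeasureTheory.integral_sub (Ki.const_mul _) ki, MeasureTheory.integral_const_mul] at h1
    have e : Real.exp (-H) * Real.exp H = 1 := by rw [← Real.exp_add]; simp
    have := mul_le_mul_of_nonneg_left h1 (Real.exp_pos (-H)).le
    set A := ∫ r in Set.Ioi a, Real.exp (h r) * (K - k) r
    set KK := ∫ r in Set.Ioi a, K r
    have e5 : Real.exp (-H) * (Real.exp H * KK) = KK := by rw [← mul_assoc, e, one_mul]
    nlinarith

lemma penrose_int (a : ℝ) (ha : 1 < a) :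
    MeasureTheory.IntegrableOn (fun r : ℝ => (2.5 / r) ^ a) (Set.Ioi 2.5) ∧
    ∫ r in Set.Ioi (2.5:ℝ), (2.5 / r) ^ a = 2.5 / (a - 1) := by
  have h25 : (0:ℝ) < 2.5 := by norm_num
  have heq : Set.EqOn (fun r : ℝ => (2.5 / r) ^ a) (fun r : ℝ => (2.5:ℝ) ^ a * r ^ (-a))
      (Set.Ioi 2.5) := by
    intro r hr
    have hr0 : (0:ℝ) < r := lt_trans h25 hr
    simp only
    rw [Real.div_rpow h25.le hr0.le, Real.rpow_neg hr0.le, div_eq_mul_inv]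
  constructor
  · refine MeasureTheory.IntegrableOn.congr_fun ?_ heq.symm measurableSet_Ioi
    exact (integrableOn_Ioi_rpow_of_lt (by linarith) h25).const_mul _
  · rw [MeasureTheory.setIntegral_congr_fun measurableSet_Ioi heq,
      MeasureTheory.integral_const_mul, integral_Ioi_rpow_of_lt (by linarith) h25]
    have : (2.5:ℝ) ^ a * (2.5:ℝ) ^ (-a+1) = 2.5 := by
      rw [← Real.rpow_add h25]; norm_num
    have h1 : a - 1 ≠ 0 := by linarith
    have h2 : -a + 1 ≠ 0 := by intro h; apply h1; linarith
    rw [eq_div_iff h1]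
    have h3 : (2.5:ℝ) ^ a * (-(2.5:ℝ) ^ (-a+1) / (-a+1)) * (a-1) = (2.5:ℝ) ^ a * (2.5:ℝ) ^ (-a+1) := by
      field_simp; ring
    rw [h3, this]

/-- `x ^ a` times an even polynomial in `x = 2.5 / r`, integrated over `r > 2.5`. -/
lemma penrose_poly (n : ℕ) (c : ℕ → ℝ) (a : ℝ) (ha : 1 < a) :
    MeasureTheory.IntegrableOn
      (fun r : ℝ => (2.5 / r) ^ a * ∑ i ∈ Finset.range n, c i * (2.5 / r) ^ (2 * i)) (Set.Ioi 2.5) ∧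
    ∫ r in Set.Ioi (2.5:ℝ), (2.5 / r) ^ a * ∑ i ∈ Finset.range n, c i * (2.5 / r) ^ (2 * i)
      = ∑ i ∈ Finset.range n, c i * (2.5 / (a + 2 * i - 1)) := by
  have heq : Set.EqOn
      (fun r : ℝ => (2.5 / r) ^ a * ∑ i ∈ Finset.range n, c i * (2.5 / r) ^ (2 * i))
      (fun r : ℝ => ∑ i ∈ Finset.range n, c i * (2.5 / r) ^ (a + 2 * i)) (Set.Ioi 2.5) := by
    intro r hr
    have hr0 : (0:ℝ) < 2.5 / r := div_pos (by norm_num) (lt_trans (by norm_num) hr)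
    simp only [Finset.mul_sum]
    refine Finset.sum_congr rfl fun i _ => ?_
    rw [Real.rpow_add hr0, ← Real.rpow_natCast (2.5 / r) (2 * i)]
    push_cast; ring
  have key : ∀ i : ℕ, 1 < a + 2 * (i : ℝ) := fun i => by
    have : (0:ℝ) ≤ i := Nat.cast_nonneg i
    linarith
  constructor
  · refine MeasureTheory.IntegrableOn.congr_fun ?_ heq.symm measurableSet_Ioi
    exact MeasureTheory.integrable_finsetSum _ fun i _ => (penrose_int _ (key i)).1.const_mul _
  · rw [MeasureTheory.setIntegral_congr_fun measurableSet_Ioi heq,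
      MeasureTheory.integral_finsetSum _ fun i _ => (penrose_int _ (key i)).1.const_mul _]
    refine Finset.sum_congr rfl fun i _ => ?_
    rw [MeasureTheory.integral_const_mul, (penrose_int _ (key i)).2]

noncomputable def penQ (D : ℝ) : ℕ → ℝ
  | 0 => D ^ 2
  | 1 => -2 * 1.6384 * D * (D + 2)
  | 2 => 1.6384 ^ 2 * (D + 2) ^ 2 + 2 * 0.84934656 * D * (D + 4)
  | 3 => -2 * 1.6384 * 0.84934656 * (D + 2) * (D + 4)
  | 4 => 0.84934656 ^ 2 * (D + 4) ^ 2
  | _ => 0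

noncomputable def penP2 : ℕ → ℝ
  | 0 => (1 / 1)
  | 1 => (-2048 / 625)
  | 2 => (1712128 / 390625)
  | 3 => (-679477248 / 244140625)
  | 4 => (110075314176 / 152587890625)
  | _ => 0

noncomputable def penP3 : ℕ → ℝ
  | 0 => (-1 / 1)
  | 1 => (3072 / 625)
  | 2 => (-4141056 / 390625)
  | 3 => (3112173568 / 244140625)
  | 4 => (-1373902995456 / 152587890625)
  | 5 => (338151365148672 / 95367431640625)
  | 6 => (-36520347436056576 / 59604644775390625)
  | _ => 0

noncomputable def penP4 : ℕ → ℝ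
  | 0 => (1 / 1)
  | 1 => (-4096 / 625)
  | 2 => (1523712 / 78125)
  | 3 => (-8371830784 / 244140625)
  | 4 => (5934671724544 / 152587890625)
  | 5 => (-2777572530192384 / 95367431640625)
  | 6 => (167723077113741312 / 11920928955078125)
  | 7 => (-149587343098087735296 / 37252902984619140625)
  | 8 => (12116574790945106558976 / 23283064365386962890625)
  | _ => 0

lemma pen_div_le (c d b : ℝ) (hd : 0 < d) (h : c * 2.5 ≤ b * d) : c * (2.5 / d) ≤ b := by
  rw [← mul_div_assoc, div_le_iff₀ hd]; exact h

lemma pen_le_div (c d b : ℝ) (hd : 0 < d) (h : b * d ≤ c * 2.5) : b ≤ c * (2.5 / d) := by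
  rw [← mul_div_assoc, le_div_iff₀ hd]; exact h

lemma pen_n1 (D : ℝ) (h1 : 2.5606601 ≤ D) (h2 : D ≤ 2.5606602) (h3 : D ^ 2 = 3 * D - 9 / 8) :
    ∑ i ∈ Finset.range 5, penQ D i * (2.5 / ((2 * D + 1) + 2 * (i : ℝ) - 1)) ≤ (87877 / 1000000 : ℝ) := by
  have e0 := pen_div_le (penQ D 0) ((2 * D + 1) + 2 * ((0 : ℕ) : ℝ) - 1) (320082527 / 100000000)
    (by push_cast; linarith) (by simp only [penQ]; push_cast; nlinarith)
  have e1 := pen_div_le (penQ D 1) ((2 * D + 1) + 2 * ((1 : ℕ) : ℝ) - 1) (-13434115251 / 1000000000)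
    (by push_cast; linarith) (by simp only [penQ]; push_cast; nlinarith)
  have e2 := pen_div_le (penQ D 2) ((2 * D + 1) + 2 * ((2 : ℕ) : ℝ) - 1) (23124656431 / 1000000000)
    (by push_cast; linarith) (by simp only [penQ]; push_cast; nlinarith)
  have e3 := pen_div_le (penQ D 3) ((2 * D + 1) + 2 * ((3 : ℕ) : ℝ) - 1) (-18719479741 / 1000000000)
    (by push_cast; linarith) (by simp only [penQ]; push_cast; nlinarith)
  have e4 := pen_div_le (penQ D 4) ((2 * D + 1) + 2 * ((4 : ℕ) : ℝ) - 1) (1183197979 / 200000000)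
    (by push_cast; linarith) (by simp only [penQ]; push_cast; nlinarith)
  simp only [Finset.sum_range_succ, Finset.sum_range_zero]
  linarith

lemma pen_n2 (D : ℝ) (h1 : 2.5606601 ≤ D) (h2 : D ≤ 2.5606602) (h3 : D ^ 2 = 3 * D - 9 / 8) :
    ∑ i ∈ Finset.range 5, penQ D i * (2.5 / ((2 * D) + 2 * (i : ℝ) - 1)) ≤ (487 / 3125 : ℝ) := by
  have e0 := pen_div_le (penQ D 0) ((2 * D) + 2 * ((0 : ℕ) : ℝ) - 1) (1988737849 / 500000000)
    (by push_cast; linarith) (by simp only [penQ]; push_cast; nlinarith)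
  have e1 := pen_div_le (penQ D 1) ((2 * D) + 2 * ((1 : ℕ) : ℝ) - 1) (-15628758699 / 1000000000)
    (by push_cast; linarith) (by simp only [penQ]; push_cast; nlinarith)
  have e2 := pen_div_le (penQ D 2) ((2 * D) + 2 * ((2 : ℕ) : ℝ) - 1) (25972057503 / 1000000000)
    (by push_cast; linarith) (by simp only [penQ]; push_cast; nlinarith)
  have e3 := pen_div_le (penQ D 3) ((2 * D) + 2 * ((3 : ℕ) : ℝ) - 1) (-5142247357 / 250000000)
    (by push_cast; linarith) (by simp only [penQ]; push_cast; nlinarith)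
  have e4 := pen_div_le (penQ D 4) ((2 * D) + 2 * ((4 : ℕ) : ℝ) - 1) (64040547 / 10000000)
    (by push_cast; linarith) (by simp only [penQ]; push_cast; nlinarith)
  simp only [Finset.sum_range_succ, Finset.sum_range_zero]
  linarith

lemma pen_n3 (D : ℝ) (h1 : 2.5606601 ≤ D) (h2 : D ≤ 2.5606602) (h3 : D ^ 2 = 3 * D - 9 / 8) :
    ∑ i ∈ Finset.range 5, penQ D i * (2.5 / ((2 * D - 2) + 2 * (i : ℝ) - 1)) ≤ (1007293 / 1000000 : ℝ) := by
  have e0 := pen_div_le (penQ D 0) ((2 * D - 2) + 2 * ((0 : ℕ) : ℝ) - 1) (3863737877 / 500000000)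
    (by push_cast; linarith) (by simp only [penQ]; push_cast; nlinarith)
  have e1 := pen_div_le (penQ D 1) ((2 * D - 2) + 2 * ((1 : ℕ) : ℝ) - 1) (-2901638059 / 125000000)
    (by push_cast; linarith) (by simp only [penQ]; push_cast; nlinarith)
  have e2 := pen_div_le (penQ D 2) ((2 * D - 2) + 2 * ((2 : ℕ) : ℝ) - 1) (34457827169 / 1000000000)
    (by push_cast; linarith) (by simp only [penQ]; push_cast; nlinarith)
  have e3 := pen_div_le (penQ D 3) ((2 * D - 2) + 2 * ((3 : ℕ) : ℝ) - 1) (-12817209709 / 500000000)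
    (by push_cast; linarith) (by simp only [penQ]; push_cast; nlinarith)
  have e4 := pen_div_le (penQ D 4) ((2 * D - 2) + 2 * ((4 : ℕ) : ℝ) - 1) (1917378261 / 250000000)
    (by push_cast; linarith) (by simp only [penQ]; push_cast; nlinarith)
  simp only [Finset.sum_range_succ, Finset.sum_range_zero]
  linarith

lemma pen_n4 (D : ℝ) (h1 : 2.5606601 ≤ D) (h2 : D ≤ 2.5606602) (h3 : D ^ 2 = 3 * D - 9 / 8) :
    (3779 / 12500 : ℝ) ≤ ∑ i ∈ Finset.range 5, penP2 i * (2.5 / ((2 * D - 2) + 2 * (i : ℝ) - 1)) := by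
  have e0 := pen_le_div (penP2 0) ((2 * D - 2) + 2 * ((0 : ℕ) : ℝ) - 1) (942809 / 800000)
    (by push_cast; linarith) (by simp only [penP2]; push_cast; nlinarith)
  have e1 := pen_le_div (penP2 1) ((2 * D - 2) + 2 * ((1 : ℕ) : ℝ) - 1) (-1987712599 / 1000000000)
    (by push_cast; linarith) (by simp only [penP2]; push_cast; nlinarith)
  have e2 := pen_le_div (penP2 2) ((2 * D - 2) + 2 * ((2 : ℕ) : ℝ) - 1) (895037211 / 500000000)
    (by push_cast; linarith) (by simp only [penP2]; push_cast; nlinarith)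
  have e3 := pen_le_div (penP2 3) ((2 * D - 2) + 2 * ((3 : ℕ) : ℝ) - 1) (-428369219 / 500000000)
    (by push_cast; linarith) (by simp only [penP2]; push_cast; nlinarith)
  have e4 := pen_le_div (penP2 4) ((2 * D - 2) + 2 * ((4 : ℕ) : ℝ) - 1) (178185619 / 1000000000)
    (by push_cast; linarith) (by simp only [penP2]; push_cast; nlinarith)
  simp only [Finset.sum_range_succ, Finset.sum_range_zero]
  linarith

lemma pen_n5 (D : ℝ) (h1 : 2.5606601 ≤ D) (h2 : D ≤ 2.5606602) (h3 : D ^ 2 = 3 * D - 9 / 8) :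
    ∑ i ∈ Finset.range 7, penP3 i * (2.5 / ((3 * D - 2) + 2 * (i : ℝ) - 1)) ≤ (-27219 / 1000000 : ℝ) := by
  have e0 := pen_div_le (penP3 0) ((3 * D - 2) + 2 * ((0 : ℕ) : ℝ) - 1) (-266981019 / 500000000)
    (by push_cast; linarith) (by simp only [penP3]; push_cast; nlinarith)
  have e1 := pen_div_le (penP3 1) ((3 * D - 2) + 2 * ((1 : ℕ) : ℝ) - 1) (183897581 / 100000000)
    (by push_cast; linarith) (by simp only [penP3]; push_cast; nlinarith)
  have e2 := pen_div_le (penP3 2) ((3 * D - 2) + 2 * ((2 : ℕ) : ℝ) - 1) (-1526308307 / 500000000)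
    (by push_cast; linarith) (by simp only [penP3]; push_cast; nlinarith)
  have e3 := pen_div_le (penP3 3) ((3 * D - 2) + 2 * ((3 : ℕ) : ℝ) - 1) (2983403513 / 1000000000)
    (by push_cast; linarith) (by simp only [penP3]; push_cast; nlinarith)
  have e4 := pen_div_le (penP3 4) ((3 * D - 2) + 2 * ((4 : ℕ) : ℝ) - 1) (-177496143 / 100000000)
    (by push_cast; linarith) (by simp only [penP3]; push_cast; nlinarith)
  have e5 := pen_div_le (penP3 5) ((3 * D - 2) + 2 * ((5 : ℕ) : ℝ) - 1) (60376293 / 100000000)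
    (by push_cast; linarith) (by simp only [penP3]; push_cast; nlinarith)
  have e6 := pen_div_le (penP3 6) ((3 * D - 2) + 2 * ((6 : ℕ) : ℝ) - 1) (-45911037 / 500000000)
    (by push_cast; linarith) (by simp only [penP3]; push_cast; nlinarith)
  simp only [Finset.sum_range_succ, Finset.sum_range_zero]
  linarith

lemma pen_n6 (D : ℝ) (h1 : 2.5606601 ≤ D) (h2 : D ≤ 2.5606602) (h3 : D ^ 2 = 3 * D - 9 / 8) :
    ∑ i ∈ Finset.range 9, penP4 i * (2.5 / ((4 * D - 2) + 2 * (i : ℝ) - 1)) ≤ (863 / 250000 : ℝ) := by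
  have e0 := pen_div_le (penP4 0) ((4 * D - 2) + 2 * ((0 : ℕ) : ℝ) - 1) (345178003 / 1000000000)
    (by push_cast; linarith) (by simp only [penP4]; push_cast; nlinarith)
  have e1 := pen_div_le (penP4 1) ((4 * D - 2) + 2 * ((1 : ℕ) : ℝ) - 1) (-1772653527 / 1000000000)
    (by push_cast; linarith) (by simp only [penP4]; push_cast; nlinarith)
  have e2 := pen_div_le (penP4 2) ((4 * D - 2) + 2 * ((2 : ℕ) : ℝ) - 1) (433695133 / 100000000)
    (by push_cast; linarith) (by simp only [penP4]; push_cast; nlinarith)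
  have e3 := pen_div_le (penP4 3) ((4 * D - 2) + 2 * ((3 : ℕ) : ℝ) - 1) (-3236799527 / 500000000)
    (by push_cast; linarith) (by simp only [penP4]; push_cast; nlinarith)
  have e4 := pen_div_le (penP4 4) ((4 * D - 2) + 2 * ((4 : ℕ) : ℝ) - 1) (3189528169 / 500000000)
    (by push_cast; linarith) (by simp only [penP4]; push_cast; nlinarith)
  have e5 := pen_div_le (penP4 5) ((4 * D - 2) + 2 * ((5 : ℕ) : ℝ) - 1) (-4222810057 / 1000000000)
    (by push_cast; linarith) (by simp only [penP4]; push_cast; nlinarith)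
  have e6 := pen_div_le (penP4 6) ((4 * D - 2) + 2 * ((6 : ℕ) : ℝ) - 1) (456980933 / 250000000)
    (by push_cast; linarith) (by simp only [penP4]; push_cast; nlinarith)
  have e7 := pen_div_le (penP4 7) ((4 * D - 2) + 2 * ((7 : ℕ) : ℝ) - 1) (-472570069 / 1000000000)
    (by push_cast; linarith) (by simp only [penP4]; push_cast; nlinarith)
  have e8 := pen_div_le (penP4 8) ((4 * D - 2) + 2 * ((8 : ℕ) : ℝ) - 1) (55975043 / 1000000000)
    (by push_cast; linarith) (by simp only [penP4]; push_cast; nlinarith)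
  simp only [Finset.sum_range_succ, Finset.sum_range_zero]
  linarith

lemma pen_s_bounds (D : ℝ) (h1 : 2.5606601 ≤ D) (h2 : D ≤ 2.5606602) :
    2.9209 ≤ (1.52:ℝ) ^ D ∧ (1.52:ℝ) ^ D ≤ 2.9241 := by
  constructor
  · have a1 : (1.52:ℝ) ^ ((64:ℝ)/25) ≤ (1.52:ℝ) ^ D :=
      Real.rpow_le_rpow_of_exponent_le (by norm_num) (by linarith)
    refine le_trans ?_ a1
    have p : (0:ℝ) ≤ (1.52:ℝ) ^ ((64:ℝ)/25) := by positivity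
    refine le_of_pow_le_pow_left₀ (n := 25) (by norm_num) p ?_
    rw [← Real.rpow_natCast, ← Real.rpow_natCast, ← Real.rpow_mul (by norm_num)]
    have : (64:ℝ)/25 * ((25:ℕ):ℝ) = ((64:ℕ):ℝ) := by norm_num
    rw [this, Real.rpow_natCast, Real.rpow_natCast]
    norm_num
  · have a1 : (1.52:ℝ) ^ D ≤ (1.52:ℝ) ^ ((41:ℝ)/16) :=
      Real.rpow_le_rpow_of_exponent_le (by norm_num) (by linarith)
    refine le_trans a1 ?_
    refine le_of_pow_le_pow_left₀ (n := 16) (by norm_num) (by norm_num) ?_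
    rw [← Real.rpow_natCast, ← Real.rpow_natCast, ← Real.rpow_mul (by norm_num)]
    have : (41:ℝ)/16 * ((16:ℕ):ℝ) = ((41:ℕ):ℝ) := by norm_num
    rw [this, Real.rpow_natCast, Real.rpow_natCast]
    norm_num

lemma pen_D_bounds (D : ℝ) (hD : D = 3 / 2 + 3 / (2 * Real.sqrt 2)) :
    2.5606601 ≤ D ∧ D ≤ 2.5606602 ∧ D ^ 2 = 3 * D - 9 / 8 := by
  have h2 : Real.sqrt 2 ^ 2 = 2 := Real.sq_sqrt (by norm_num)
  have hp : 0 < Real.sqrt 2 := by positivity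
  have e : D = 3 / 2 + 3 / 4 * Real.sqrt 2 := by
    rw [hD]; field_simp; nlinarith
  have l : 1.41421354 ≤ Real.sqrt 2 := Real.le_sqrt_of_sq_le (by norm_num)
  have u : Real.sqrt 2 ≤ 1.4142136 := Real.sqrt_le_iff.2 ⟨by norm_num, by norm_num⟩
  refine ⟨by linarith, by linarith, ?_⟩
  rw [e]; nlinarith

lemma pen_final (D s : ℝ) (h1 : 2.5606601 ≤ D) (h2 : D ≤ 2.5606602) (h3 : D ^ 2 = 3 * D - 9 / 8)
    (s1 : 2.9209 ≤ s) (s2 : s ≤ 2.9241) (H KK M S1 S2 S3 S4 S5 S6 : ℝ)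
    (n1 : S1 ≤ 0.087877) (n2 : S2 ≤ 0.15584) (n3 : S3 ≤ 1.007293) (n4 : 0.30232 ≤ S4)
    (n5 : S5 ≤ -0.027219) (n6 : S6 ≤ 0.003452)
    (hH : H = s ^ 2 / 5 * S1) (hK : KK = s ^ 2 / 2 * (S2 + 6.25 * S3))
    (hM : M = 6.25 * (9 / 16 * s ^ 2 * S4 - 9 * s ^ 3 * S5 - 11 * s ^ 4 * S6)) :
    Real.exp (-H) * (2.5 + 2.5 ^ 3 - M) + KK < 2.5 + 2.5 ^ 3 := by
  have p2u : s ^ 2 ≤ 2.9241 ^ 2 := by gcongr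
  have p2l : 2.9209 ^ 2 ≤ s ^ 2 := by gcongr
  have p3l : 2.9209 ^ 3 ≤ s ^ 3 := by gcongr
  have p4u : s ^ 4 ≤ 2.9241 ^ 4 := by gcongr
  have q2 : 0 < s ^ 2 := by positivity
  have q3 : 0 < s ^ 3 := by positivity
  have q4 : 0 < s ^ 4 := by positivity
  have hH1 : H ≤ 0.1503 := by
    rw [hH]
    have := mul_le_mul_of_nonneg_left n1 q2.le
    nlinarith
  have hK1 : KK ≤ 27.582 := by
    rw [hK]
    have := mul_le_mul_of_nonneg_left n2 q2.le
    have := mul_le_mul_of_nonneg_left n3 q2.le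
    nlinarith
  have hM1 : 29.871 ≤ M := by
    rw [hM]
    have := mul_le_mul_of_nonneg_left n4 q2.le
    have := mul_le_mul_of_nonneg_left n5 q3.le
    have := mul_le_mul_of_nonneg_left n6 q4.le
    nlinarith
  have he : 0.8497 ≤ Real.exp (-H) := by
    have := Real.add_one_le_exp (-H)
    linarith
  nlinarith

lemma pen_deriv (D s r : ℝ) (hr : 0 < r) :
    HasDerivAt (fun r : ℝ => s * (2.5 / r) ^ D *
        (-1 + 1.6384 * (2.5 / r) ^ 2 - 0.84934656 * (2.5 / r) ^ 4))
      (s * (2.5 / r) ^ D * (D - 1.6384 * (D + 2) * (2.5 / r) ^ 2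
        + 0.84934656 * (D + 4) * (2.5 / r) ^ 4) * ((2.5 / r) / 2.5)) r := by
  have hx : (0:ℝ) < 2.5 / r := by positivity
  have d0 : HasDerivAt (fun r : ℝ => 2.5 / r) (-((2.5 / r) ^ 2 / 2.5)) r := by
    have := (hasDerivAt_inv hr.ne').const_mul (2.5:ℝ)
    simp only [← div_eq_mul_inv] at this
    refine this.congr_deriv ?_
    field_simp
  have d1 := d0.rpow_const (p := D) (Or.inl hx.ne')
  have d2 := (((d0.pow 2).const_mul 1.6384).const_add (-1)).sub ((d0.pow 4).const_mul 0.84934656)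
  have := (d1.const_mul s).mul d2
  refine HasDerivAt.congr_deriv this ?_
  rw [Real.rpow_sub_one hx.ne']
  generalize (2.5 / r) ^ D = y
  simp only [Pi.pow_apply, Pi.sub_apply]
  generalize 2.5 / r = x at hx
  push_cast
  field_simp
  ring

lemma pen_V_nonpos (D s x : ℝ) (hD : 2 ≤ D) (hs : 0 ≤ s) (hs2 : s ≤ 3) (hx : 0 < x) (hx1 : x ≤ 1) :
    -(9 / 16) * (s * x ^ D * (-1 + 1.6384 * x ^ 2 - 0.84934656 * x ^ 4)) ^ 2
    + 9 * (s * x ^ D * (-1 + 1.6384 * x ^ 2 - 0.84934656 * x ^ 4)) ^ 3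
    + 11 * (s * x ^ D * (-1 + 1.6384 * x ^ 2 - 0.84934656 * x ^ 4)) ^ 4 ≤ 0 := by
  have hy : x ^ D ≤ x ^ 2 := by
    rw [← Real.rpow_natCast]
    exact Real.rpow_le_rpow_of_exponent_ge hx hx1 (by push_cast; exact hD)
  have hy0 : 0 < x ^ D := by positivity
  have hP : 0 ≤ 1 - 1.6384 * x ^ 2 + 0.84934656 * x ^ 4 := by
    nlinarith [sq_nonneg (x ^ 2 - 0.96)]
  have hc : x ^ 2 * (1 - 1.6384 * x ^ 2 + 0.84934656 * x ^ 4) ≤ 0.25 := by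
    have hu0 : 0 ≤ x ^ 2 := by positivity
    have hu1 : x ^ 2 ≤ 1 := by nlinarith
    have e : x ^ 4 = (x ^ 2) ^ 2 := by ring
    rw [e]
    generalize x ^ 2 = u at hu0 hu1
    nlinarith [mul_nonneg hu0 (sq_nonneg (u - 0.5)), mul_nonneg (sub_nonneg.2 hu1) (sq_nonneg (u - 0.5)),
      mul_nonneg hu0 (sub_nonneg.2 hu1), mul_nonneg hu0 (sq_nonneg (u - 0.9)),
      mul_nonneg (sub_nonneg.2 hu1) (sq_nonneg (u - 0.45))]
  have hb : x ^ D * (1 - 1.6384 * x ^ 2 + 0.84934656 * x ^ 4) ≤ 0.25 :=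
    le_trans (mul_le_mul_of_nonneg_right hy hP) hc
  have hb0 := mul_nonneg hy0.le hP
  have e : s * x ^ D * (-1 + 1.6384 * x ^ 2 - 0.84934656 * x ^ 4)
    = -(s * (x ^ D * (1 - 1.6384 * x ^ 2 + 0.84934656 * x ^ 4))) := by ring
  rw [e]
  generalize x ^ D * (1 - 1.6384 * x ^ 2 + 0.84934656 * x ^ 4) = w at hb hb0
  have hY0 : 0 ≤ s * w := mul_nonneg hs hb0
  have hY1 : s * w ≤ 0.75 := by nlinarith
  generalize s * w = Y at hY0 hY1
  have : -(9 / 16) * (-Y) ^ 2 + 9 * (-Y) ^ 3 + 11 * (-Y) ^ 4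
    = Y ^ 2 * (-(9 / 16) - 9 * Y + 11 * Y ^ 2) := by ring
  rw [this]
  exact mul_nonpos_of_nonneg_of_nonpos (sq_nonneg Y) (by nlinarith)

set_option maxHeartbeats 2000000 in
theorem explicit_dataset_violates_penrose
    (r₀ Δ ω₀ : ℝ) (hr₀ : r₀ = 2.5)
    (hΔ : Δ = 3 / 2 + 3 / (2 * Real.sqrt 2))
    (hω₀ : ω₀ = r₀ + r₀ ^ 3)
    (V φ h χ ω : ℝ → ℝ)
    (hV : ∀ x, V x = -(9 / 16) * x ^ 2 + 9 * x ^ 3 + 11 * x ^ 4)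
    (hφ : ∀ r ≥ r₀, φ r = (3.8 / r) ^ Δ * (-1 + (3.2 / r) ^ 2 - (2.4 / r) ^ 4))
    (hh : ∀ r, h r = (1 / 2) * ∫ ρ in r₀..r, ρ * deriv φ ρ ^ 2)
    (hχ : ∀ r, χ r = (1 + r ^ 2) * deriv φ r ^ 2 + 2 * V (φ r))
    (hω : ∀ r, ω r = Real.exp (-h r) *
      (ω₀ + (1 / 2) * ∫ ρ in r₀..r, Real.exp (h ρ) * ρ ^ 2 * χ ρ)) :
    ∃ ωinf : ℝ, Tendsto ω atTop (nhds ωinf) ∧ ωinf < r₀ + r₀ ^ 3 := by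
  obtain ⟨h1, h2, h3⟩ := pen_D_bounds Δ hΔ
  obtain ⟨s1, s2⟩ := pen_s_bounds Δ h1 h2
  clear hΔ
  subst hr₀
  set s := (1.52:ℝ) ^ Δ with hs
  have hφ1 : ∀ r ≥ (2.5:ℝ), φ r = s * (2.5 / r) ^ Δ *
        (-1 + 1.6384 * (2.5 / r) ^ 2 - 0.84934656 * (2.5 / r) ^ 4) := by
    intro r hr
    have hr0 : (0:ℝ) < r := lt_of_lt_of_le (by norm_num) hr
    rw [hφ r hr, hs, ← Real.mul_rpow (by norm_num) (by positivity)]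
    have e1 : (1.52:ℝ) * (2.5 / r) = 3.8 / r := by field_simp; norm_num
    rw [e1]
    congr 1
    field_simp
    norm_num
  have hd : ∀ r > (2.5:ℝ), deriv φ r = s * (2.5 / r) ^ Δ * (Δ - 1.6384 * (Δ + 2) * (2.5 / r) ^ 2
        + 0.84934656 * (Δ + 4) * (2.5 / r) ^ 4) * ((2.5 / r) / 2.5) := by
    intro r hr
    have hr0 : (0:ℝ) < r := lt_trans (by norm_num) hr
    refine ((pen_deriv Δ s r hr0).congr_of_eventuallyEq ?_).deriv
    filter_upwards [eventually_gt_nhds hr] with y hy using hφ1 y (le_of_lt hy)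
  -- exponents
  have hpow : ∀ x : ℝ, 0 < x → x ^ (2 * Δ + 1) = (x ^ Δ) ^ 2 * x ∧ x ^ (2 * Δ) = (x ^ Δ) ^ 2 ∧
      x ^ (2 * Δ - 2) = (x ^ Δ) ^ 2 / x ^ 2 ∧ x ^ (3 * Δ - 2) = (x ^ Δ) ^ 3 / x ^ 2 ∧
      x ^ (4 * Δ - 2) = (x ^ Δ) ^ 4 / x ^ 2 := by
    intro x hx
    have c2 : x ^ (2 * Δ) = (x ^ Δ) ^ 2 := by
      rw [← Real.rpow_natCast (x ^ Δ), ← Real.rpow_mul hx.le, mul_comm]; norm_num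
    have c3 : x ^ (3 * Δ) = (x ^ Δ) ^ 3 := by
      rw [← Real.rpow_natCast (x ^ Δ), ← Real.rpow_mul hx.le, mul_comm]; norm_num
    have c4 : x ^ (4 * Δ) = (x ^ Δ) ^ 4 := by
      rw [← Real.rpow_natCast (x ^ Δ), ← Real.rpow_mul hx.le, mul_comm]; norm_num
    have c0 : x ^ (2:ℝ) = x ^ 2 := by exact_mod_cast Real.rpow_natCast x 2
    refine ⟨?_, c2, ?_, ?_, ?_⟩
    · rw [Real.rpow_add_one hx.ne', c2]
    · rw [Real.rpow_sub hx, c2, c0]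
    · rw [Real.rpow_sub hx, c3, c0]
    · rw [Real.rpow_sub hx, c4, c0]
  obtain ⟨i1, v1⟩ := penrose_poly 5 (penQ Δ) (2 * Δ + 1) (by linarith)
  obtain ⟨i2, v2⟩ := penrose_poly 5 (penQ Δ) (2 * Δ) (by linarith)
  obtain ⟨i3, v3⟩ := penrose_poly 5 (penQ Δ) (2 * Δ - 2) (by linarith)
  obtain ⟨i4, v4⟩ := penrose_poly 5 penP2 (2 * Δ - 2) (by linarith)
  obtain ⟨i5, v5⟩ := penrose_poly 7 penP3 (3 * Δ - 2) (by linarith)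
  obtain ⟨i6, v6⟩ := penrose_poly 9 penP4 (4 * Δ - 2) (by linarith)
  have n1 := pen_n1 Δ h1 h2 h3
  have n2 := pen_n2 Δ h1 h2 h3
  have n3 := pen_n3 Δ h1 h2 h3
  have n4 := pen_n4 Δ h1 h2 h3
  have n5 := pen_n5 Δ h1 h2 h3
  have n6 := pen_n6 Δ h1 h2 h3
  rw [← v1] at n1
  rw [← v2] at n2
  rw [← v3] at n3
  rw [← v4] at n4
  rw [← v5] at n5
  rw [← v6] at n6
  clear v1 v2 v3 v4 v5 v6
  have sQ : ∀ x : ℝ, ∑ i ∈ Finset.range 5, penQ Δ i * x ^ (2 * i) =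
      (Δ - 1.6384 * (Δ + 2) * x ^ 2 + 0.84934656 * (Δ + 4) * x ^ 4) ^ 2 := by
    intro x
    simp only [Finset.sum_range_succ, Finset.sum_range_zero, penQ]
    ring
  have sP2 : ∀ x : ℝ, ∑ i ∈ Finset.range 5, penP2 i * x ^ (2 * i) =
      (-1 + 1.6384 * x ^ 2 - 0.84934656 * x ^ 4) ^ 2 := by
    intro x
    simp only [Finset.sum_range_succ, Finset.sum_range_zero, penP2]
    ring
  have sP3 : ∀ x : ℝ, ∑ i ∈ Finset.range 7, penP3 i * x ^ (2 * i) =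
      (-1 + 1.6384 * x ^ 2 - 0.84934656 * x ^ 4) ^ 3 := by
    intro x
    simp only [Finset.sum_range_succ, Finset.sum_range_zero, penP3]
    ring
  have sP4 : ∀ x : ℝ, ∑ i ∈ Finset.range 9, penP4 i * x ^ (2 * i) =
      (-1 + 1.6384 * x ^ 2 - 0.84934656 * x ^ 4) ^ 4 := by
    intro x
    simp only [Finset.sum_range_succ, Finset.sum_range_zero, penP4]
    ring
  simp only [sQ, sP2, sP3, sP4] at i1 i2 i3 i4 i5 i6 n1 n2 n3 n4 n5 n6
  have hxr : ∀ r > (2.5:ℝ), 0 < 2.5 / r ∧ 2.5 / r ≤ 1 ∧ r = 2.5 / (2.5 / r) := by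
    intro r hr
    have hr0 : (0:ℝ) < r := lt_trans (by norm_num) hr
    refine ⟨by positivity, (div_le_one hr0).2 (le_of_lt hr), by field_simp⟩
  -- the three densities
  have ef : Set.EqOn (fun ρ => 1 / 2 * (ρ * deriv φ ρ ^ 2))
      (fun r => s ^ 2 / 5 * ((2.5 / r) ^ (2 * Δ + 1) * (Δ - 1.6384 * (Δ + 2) * (2.5 / r) ^ 2
        + 0.84934656 * (Δ + 4) * (2.5 / r) ^ 4) ^ 2)) (Set.Ioi 2.5) := by
    intro r hr
    obtain ⟨x0, x1, e⟩ := hxr r hr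
    simp only
    rw [hd r hr, (hpow _ x0).1]
    generalize (2.5 / r) ^ Δ = y
    generalize 2.5 / r = x at x0 x1 e
    rw [e]
    generalize Δ - 1.6384 * (Δ + 2) * x ^ 2 + 0.84934656 * (Δ + 4) * x ^ 4 = Q
    field_simp
    ring
  have eK : Set.EqOn (fun ρ => 1 / 2 * (ρ ^ 2 * (1 + ρ ^ 2) * deriv φ ρ ^ 2))
      (fun r => s ^ 2 / 2 * ((2.5 / r) ^ (2 * Δ) * (Δ - 1.6384 * (Δ + 2) * (2.5 / r) ^ 2
        + 0.84934656 * (Δ + 4) * (2.5 / r) ^ 4) ^ 2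
        + 6.25 * ((2.5 / r) ^ (2 * Δ - 2) * (Δ - 1.6384 * (Δ + 2) * (2.5 / r) ^ 2
        + 0.84934656 * (Δ + 4) * (2.5 / r) ^ 4) ^ 2))) (Set.Ioi 2.5) := by
    intro r hr
    obtain ⟨x0, x1, e⟩ := hxr r hr
    simp only
    rw [hd r hr, (hpow _ x0).2.1, (hpow _ x0).2.2.1]
    generalize (2.5 / r) ^ Δ = y
    generalize 2.5 / r = x at x0 x1 e
    rw [e]
    generalize Δ - 1.6384 * (Δ + 2) * x ^ 2 + 0.84934656 * (Δ + 4) * x ^ 4 = Q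
    field_simp
    ring
  have ek : Set.EqOn (fun ρ => -(ρ ^ 2 * V (φ ρ)))
      (fun r => 6.25 * (9 / 16 * s ^ 2 * ((2.5 / r) ^ (2 * Δ - 2) *
          (-1 + 1.6384 * (2.5 / r) ^ 2 - 0.84934656 * (2.5 / r) ^ 4) ^ 2)
        - 9 * s ^ 3 * ((2.5 / r) ^ (3 * Δ - 2) *
          (-1 + 1.6384 * (2.5 / r) ^ 2 - 0.84934656 * (2.5 / r) ^ 4) ^ 3)
        - 11 * s ^ 4 * ((2.5 / r) ^ (4 * Δ - 2) *
          (-1 + 1.6384 * (2.5 / r) ^ 2 - 0.84934656 * (2.5 / r) ^ 4) ^ 4))) (Set.Ioi 2.5) := by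
    intro r hr
    obtain ⟨x0, x1, e⟩ := hxr r hr
    simp only
    rw [hV, hφ1 r (le_of_lt hr), (hpow _ x0).2.2.1, (hpow _ x0).2.2.2.1, (hpow _ x0).2.2.2.2]
    generalize (2.5 / r) ^ Δ = y
    generalize 2.5 / r = x at x0 x1 e
    rw [e]
    generalize -1 + 1.6384 * x ^ 2 - 0.84934656 * x ^ 4 = P
    field_simp
    ring
  have mI : MeasurableSet (Set.Ioi (2.5:ℝ)) := measurableSet_Ioi
  have j4 := i4.const_mul (9 / 16 * s ^ 2)
  have j5 := i5.const_mul (9 * s ^ 3)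
  have j6 := i6.const_mul (11 * s ^ 4)
  have vf := MeasureTheory.setIntegral_congr_fun (μ := MeasureTheory.volume) mI ef
  have vK := MeasureTheory.setIntegral_congr_fun (μ := MeasureTheory.volume) mI eK
  have vk := MeasureTheory.setIntegral_congr_fun (μ := MeasureTheory.volume) mI ek
  rw [MeasureTheory.integral_const_mul (s ^ 2 / 5)] at vf
  rw [MeasureTheory.integral_const_mul (s ^ 2 / 2)] at vK
  rw [MeasureTheory.integral_const_mul (6.25:ℝ)] at vk
  rw [MeasureTheory.integral_add i2 (i3.const_mul _), MeasureTheory.integral_const_mul (6.25:ℝ)] at vK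
  have w1 := MeasureTheory.integral_sub (j4.sub j5) j6
  simp only [Pi.sub_apply] at w1
  rw [w1, MeasureTheory.integral_sub j4 j5,
    MeasureTheory.integral_const_mul, MeasureTheory.integral_const_mul,
    MeasureTheory.integral_const_mul] at vk
  have g1 : ∀ r > (2.5:ℝ), 0 ≤ 1 / 2 * (r * deriv φ r ^ 2) := by
    intro r hr
    have hr0 : (0:ℝ) < r := lt_trans (by norm_num) hr
    positivity
  have g2 : ∀ r > (2.5:ℝ), 0 ≤ 1 / 2 * (r ^ 2 * (1 + r ^ 2) * deriv φ r ^ 2) := by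
    intro r hr
    positivity
  have g3 : ∀ r > (2.5:ℝ), 0 ≤ -(r ^ 2 * V (φ r)) := by
    intro r hr
    obtain ⟨x0, x1, -⟩ := hxr r hr
    have := pen_V_nonpos Δ s (2.5 / r) (by linarith) (by linarith) (by linarith) x0 x1
    rw [hV, hφ1 r (le_of_lt hr)]
    have := mul_nonpos_of_nonneg_of_nonpos (sq_nonneg r) this
    linarith
  have g4 : ∀ r ≥ (2.5:ℝ), h r = ∫ ρ in (2.5:ℝ)..r, 1 / 2 * (ρ * deriv φ ρ ^ 2) := by
    intro r _
    rw [hh, intervalIntegral.integral_const_mul]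
  have g5 : ∀ r ≥ (2.5:ℝ), ω r = Real.exp (-h r) * (ω₀ + ∫ ρ in (2.5:ℝ)..r, Real.exp (h ρ) *
      (1 / 2 * (ρ ^ 2 * (1 + ρ ^ 2) * deriv φ ρ ^ 2) - -(ρ ^ 2 * V (φ ρ)))) := by
    intro r _
    rw [hω, ← intervalIntegral.integral_const_mul]
    congr 3
    funext ρ
    rw [hχ]
    ring
  obtain ⟨L, hL, hb⟩ := penrose_core 2.5 ω₀ _ _ _ h ω g1 g2 g3
    (MeasureTheory.IntegrableOn.congr_fun (i1.const_mul _) ef.symm mI)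
    (MeasureTheory.IntegrableOn.congr_fun ((i2.add (i3.const_mul _)).const_mul _) eK.symm mI)
    (MeasureTheory.IntegrableOn.congr_fun (((j4.sub j5).sub j6).const_mul _) ek.symm mI)
    g4 g5
  refine ⟨L, hL, lt_of_le_of_lt hb ?_⟩
  rw [hω₀]
  exact pen_final Δ s h1 h2 h3 s1 s2 _ _ _ _ _ _ _ _ _ (n1.trans (by norm_num))
    (n2.trans (by norm_num)) (n3.trans (by norm_num)) (le_trans (by norm_num) n4)
    (n5.trans (by norm_num)) (n6.trans (by norm_num)) vf vK vk
end

section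
/- Let d = 3, L = 1, V(φ) = −(9/16)φ² + 9φ³ + 11φ⁴, Δ = 3/2 + 3/(2√2), r₀ = 2.5, and ω₀ = r₀ + r₀³. Define φ(r) = (3.8/r)^Δ · [ −1 + (3.2/r)² − (2.4/r)⁴ ] for r ≥ r₀, h(r) = (1/2) ∫_{r₀}^{r} ρ·φ′(ρ)² dρ, χ(r) = (1 + r²)·φ′(r)² + 2V(φ(r)), and ω(r) = e^{−h(r)} [ ω₀ + (1/2) ∫_{r₀}^{r} e^{h(ρ)} ρ² χ(ρ) dρ ]. Then the limit ω_∞ = lim_{r→∞} ω(r) exists and satisfies 12 < ω_∞ < 16. -/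
open Filter

namespace MassEst

open MeasureTheory Set

/-- Horner evaluation of a list of rational coefficients. -/
noncomputable def hor : List ℚ → ℝ → ℝ
  | [], _ => 0
  | c :: l, u => (c : ℝ) + u * hor l u

def lsc (c : ℚ) : List ℚ → List ℚ
  | [] => []
  | x :: l => (c * x) :: lsc c l

def ladd : List ℚ → List ℚ → List ℚ
  | [], m => m
  | x :: l, [] => x :: l
  | x :: l, y :: m => (x + y) :: ladd l m

def lmul : List ℚ → List ℚ → List ℚ
  | [], _ => []
  | c :: l, m => ladd (lsc c m) (0 :: lmul l m)

def lint (a : ℚ) : List ℚ → List ℚ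
  | [] => []
  | c :: l => (c / (a - 1)) :: lint (a + 2) l

def lsum : List ℚ → ℚ
  | [] => 0
  | c :: l => c + lsum l

def lval (a : ℚ) (l : List ℚ) : ℚ := 5 / 2 * lsum (lint a l)

lemma hor_lsc (c : ℚ) (l : List ℚ) (u : ℝ) : hor (lsc c l) u = c * hor l u := by
  induction l with
  | nil => simp [hor, lsc]
  | cons x l ih => simp only [hor, lsc, ih]; push_cast; ring

lemma hor_ladd (l m : List ℚ) (u : ℝ) : hor (ladd l m) u = hor l u + hor m u := by
  induction l generalizing m with
  | nil => simp [hor, ladd]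
  | cons x l ih =>
    cases m with
    | nil => simp [hor, ladd]
    | cons y m => simp only [hor, ladd, ih]; push_cast; ring

lemma hor_lmul (l m : List ℚ) (u : ℝ) : hor (lmul l m) u = hor l u * hor m u := by
  induction l with
  | nil => simp [hor, lmul]
  | cons x l ih => simp only [lmul, hor_ladd, hor_lsc, hor, ih]; push_cast; ring

lemma hor_one (l : List ℚ) : hor l 1 = (lsum l : ℝ) := by
  induction l with
  | nil => simp [hor, lsum]
  | cons x l ih => simp [hor, lsum, ih]

/-- Generalized polynomial in `t = (5/2)/r`. -/
noncomputable def G (a : ℚ) (l : List ℚ) (r : ℝ) : ℝ :=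
  (5 / 2 / r) ^ (a : ℝ) * hor l ((5 / 2 / r) ^ 2)

lemma G_mul (a b : ℚ) (l m : List ℚ) {r : ℝ} (hr : 0 < r) :
    G a l r * G b m r = G (a + b) (lmul l m) r := by
  have ht : 0 < 5 / 2 / r := by positivity
  simp only [G, hor_lmul]
  push_cast
  rw [Real.rpow_add ht]; ring

lemma G_cons (a c : ℚ) (l : List ℚ) {r : ℝ} (hr : 0 < r) :
    G a (c :: l) r = c * (5 / 2 / r) ^ (a : ℝ) + G (a + 2) l r := by
  have ht : 0 < 5 / 2 / r := by positivity
  simp only [G, hor]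
  push_cast
  rw [Real.rpow_add ht]
  norm_num
  ring

lemma mono_int (a : ℝ) (ha : 1 < a) {R : ℝ} (hR : 0 < R) :
    IntegrableOn (fun r : ℝ => (5 / 2 / r) ^ a) (Ioi R) ∧
    ∫ r in Ioi R, (5 / 2 / r : ℝ) ^ a = R * (5 / 2 / R) ^ a / (a - 1) := by
  have key : ∀ r ∈ Ioi R, (5 / 2 / r : ℝ) ^ a = (5 / 2) ^ a * r ^ (-a) := by
    intro r hr
    have : 0 < r := hR.trans hr
    rw [Real.div_rpow (by norm_num) this.le, Real.rpow_neg this.le]; rfl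
  constructor
  · rw [integrableOn_congr_fun key measurableSet_Ioi]
    exact (integrableOn_Ioi_rpow_of_lt (by linarith) hR).const_mul _
  · rw [setIntegral_congr_fun measurableSet_Ioi key, integral_const_mul,
      integral_Ioi_rpow_of_lt (by linarith) hR, Real.div_rpow (by norm_num) hR.le,
      Real.rpow_add hR, Real.rpow_neg hR.le, Real.rpow_one]
    have h1 : -a + 1 ≠ 0 := by linarith
    have h2 : a - 1 ≠ 0 := by linarith
    have h3 : R ^ a ≠ 0 := (Real.rpow_pos_of_pos hR a).ne'
    have h4 : -a + 1 = -(a - 1) := by ring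
    rw [h4]
    field_simp

lemma G_int (a : ℚ) (ha : 1 < a) (l : List ℚ) {R : ℝ} (hR : 0 < R) :
    IntegrableOn (G a l) (Ioi R) ∧ ∫ r in Ioi R, G a l r = R * G a (lint a l) R := by
  induction l generalizing a with
  | nil =>
    have : G a [] = fun _ => 0 := by funext r; simp [G, hor]
    rw [this]; simp [lint, G, hor]
  | cons c l ih =>
    have key : ∀ r ∈ Ioi R, G a (c :: l) r = c * (5 / 2 / r) ^ (a : ℝ) + G (a + 2) l r :=
      fun r hr => G_cons a c l (hR.trans hr)
    have ha' : (1 : ℝ) < a := by exact_mod_cast ha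
    obtain ⟨i1, i2⟩ := ih (a + 2) (by linarith)
    obtain ⟨j1, j2⟩ := mono_int a ha' hR
    constructor
    · rw [integrableOn_congr_fun key measurableSet_Ioi]
      exact (j1.const_mul _).add i1
    · rw [setIntegral_congr_fun measurableSet_Ioi key, integral_add (j1.const_mul _) i1,
        integral_const_mul, j2, i2, lint, G_cons _ _ _ hR]
      push_cast
      ring

lemma G_val (a : ℚ) (ha : 1 < a) (l : List ℚ) :
    ∫ r in Ioi (5 / 2 : ℝ), G a l r = (lval a l : ℝ) := by
  rw [(G_int a ha l (by norm_num)).2, G, lval]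
  rw [div_self (by norm_num)]
  simp [hor_one]

/-! The concrete polynomials. -/
def ca : ℚ := 1024 / 625
def cb : ℚ := 331776 / 390625
def Ql : List ℚ := [1, -ca, cb]
def pl (d : ℚ) : List ℚ := [-d, (d + 2) * ca, -(d + 4) * cb]
def p2 (d : ℚ) : List ℚ := lmul (pl d) (pl d)
def Q2 : List ℚ := lmul Ql Ql

noncomputable def Qf (u : ℝ) : ℝ := 1 - 1024 / 625 * u + 331776 / 390625 * u ^ 2
noncomputable def pf (d u : ℝ) : ℝ :=
  -d + (d + 2) * (1024 / 625) * u - (d + 4) * (331776 / 390625) * u ^ 2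

lemma hor_Ql (u : ℝ) : hor Ql u = Qf u := by
  simp only [hor, Ql, Qf, ca, cb]; push_cast; ring

lemma hor_pl (d : ℚ) (u : ℝ) : hor (pl d) u = pf d u := by
  simp only [hor, pl, pf, ca, cb]; push_cast; ring

lemma Qf_pos (u : ℝ) : 0 < Qf u := by
  unfold Qf; nlinarith [sq_nonneg (u - 0.9645)]

lemma pf_bounds (D u : ℝ) (h1 : 2.5606 ≤ D) (h2 : D ≤ 2.5607) :
    pf 2.5606 u ^ 2 ≤ pf D u ^ 2 ∧ pf D u ^ 2 ≤ pf 2.5607 u ^ 2 := by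
  have e : ∀ x y, pf x u - pf y u = -(x - y) * Qf u := by intro x y; unfold pf Qf; ring
  have hneg : pf 2.5606 u < 0 := by unfold pf; nlinarith [sq_nonneg (u - 0.67)]
  have hQ := Qf_pos u
  have a1 : pf D u ≤ pf 2.5606 u := by have := e D 2.5606; nlinarith
  have a2 : pf 2.5607 u ≤ pf D u := by have := e 2.5607 D; nlinarith
  constructor <;> nlinarith

/-! Lists for the five building blocks; `d` exponent, `e` coefficient in `p`, `C` prefactor. -/
def Kl (e C : ℚ) : List ℚ := lsc (C ^ 2 / 5) (p2 e)
def El (d e C : ℚ) : List ℚ := lsc (5 / 2) (lint (2 * d + 1) (Kl e C))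
def T1l (e C : ℚ) : List ℚ := lsc (C ^ 2 / 2) (lmul [25 / 4, 1] (p2 e))
def T2l (C : ℚ) : List ℚ := lsc (9 / 16 * (25 / 4) * C ^ 2) Q2
def T3l (C : ℚ) : List ℚ := lsc (9 * (25 / 4) * C ^ 3) (lmul Q2 Ql)
def T4l (C : ℚ) : List ℚ := lsc (11 * (25 / 4) * C ^ 4) (lmul Q2 Q2)

/-! Exact building blocks as functions of `y`, `p`-exponent, `r`. -/
noncomputable def Kf (y e r : ℝ) : ℝ := 1 / 2 * (r * (y * pf e ((5 / 2 / r) ^ 2) / r) ^ 2)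
noncomputable def T1f (y e r : ℝ) : ℝ :=
  1 / 2 * (r ^ 2 * (1 + r ^ 2) * (y * pf e ((5 / 2 / r) ^ 2) / r) ^ 2)
noncomputable def T2f (y r : ℝ) : ℝ := 9 / 16 * r ^ 2 * (y * Qf ((5 / 2 / r) ^ 2)) ^ 2
noncomputable def T3f (y r : ℝ) : ℝ := 9 * r ^ 2 * (y * Qf ((5 / 2 / r) ^ 2)) ^ 3
noncomputable def T4f (y r : ℝ) : ℝ := 11 * r ^ 2 * (y * Qf ((5 / 2 / r) ^ 2)) ^ 4

lemma rpow_nat_mul {t : ℝ} (ht : 0 < t) (d : ℝ) (k : ℕ) : t ^ ((k : ℝ) * d) = (t ^ d) ^ k := by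
  rw [mul_comm, Real.rpow_mul ht.le, Real.rpow_natCast]

lemma Kf_eq (d e C : ℚ) {r : ℝ} (hr : 0 < r) :
    Kf (C * (5 / 2 / r) ^ (d : ℝ)) e r = G (2 * d + 1) (Kl e C) r := by
  have ht : 0 < 5 / 2 / r := by positivity
  have h2 := rpow_nat_mul ht d 2
  simp only [G, Kl, Kf, p2, hor_lsc, hor_lmul, hor_pl]
  push_cast at h2 ⊢
  rw [Real.rpow_add ht, h2, Real.rpow_one]
  field_simp

lemma T1f_eq (d e C : ℚ) {r : ℝ} (hr : 0 < r) :
    T1f (C * (5 / 2 / r) ^ (d : ℝ)) e r = G (2 * d - 2) (T1l e C) r := by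
  have ht : 0 < 5 / 2 / r := by positivity
  have h2 := rpow_nat_mul ht d 2
  simp only [G, T1l, T1f, p2, hor_lsc, hor_lmul, hor_pl, hor]
  push_cast at h2 ⊢
  rw [Real.rpow_sub ht, h2, Real.rpow_two]
  generalize (5 / 2 / r) ^ (d : ℝ) = z
  generalize pf (d := (e : ℝ)) ((5 / 2 / r) ^ 2) = w
  field_simp
  ring

lemma T2f_eq (d C : ℚ) {r : ℝ} (hr : 0 < r) :
    T2f (C * (5 / 2 / r) ^ (d : ℝ)) r = G (2 * d - 2) (T2l C) r := by
  have ht : 0 < 5 / 2 / r := by positivity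
  have h2 := rpow_nat_mul ht d 2
  simp only [G, T2l, T2f, Q2, hor_lsc, hor_lmul, hor_Ql]
  push_cast at h2 ⊢
  rw [Real.rpow_sub ht, h2, Real.rpow_two]
  generalize (5 / 2 / r) ^ (d : ℝ) = z
  generalize Qf ((5 / 2 / r) ^ 2) = w
  field_simp
  ring

lemma T3f_eq (d C : ℚ) {r : ℝ} (hr : 0 < r) :
    T3f (C * (5 / 2 / r) ^ (d : ℝ)) r = G (3 * d - 2) (T3l C) r := by
  have ht : 0 < 5 / 2 / r := by positivity
  have h2 := rpow_nat_mul ht d 3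
  simp only [G, T3l, T3f, Q2, hor_lsc, hor_lmul, hor_Ql]
  push_cast at h2 ⊢
  rw [Real.rpow_sub ht, h2, Real.rpow_two]
  generalize (5 / 2 / r) ^ (d : ℝ) = z
  generalize Qf ((5 / 2 / r) ^ 2) = w
  field_simp
  ring

lemma T4f_eq (d C : ℚ) {r : ℝ} (hr : 0 < r) :
    T4f (C * (5 / 2 / r) ^ (d : ℝ)) r = G (4 * d - 2) (T4l C) r := by
  have ht : 0 < 5 / 2 / r := by positivity
  have h2 := rpow_nat_mul ht d 4
  simp only [G, T4l, T4f, Q2, hor_lsc, hor_lmul, hor_Ql]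
  push_cast at h2 ⊢
  rw [Real.rpow_sub ht, h2, Real.rpow_two]
  generalize (5 / 2 / r) ^ (d : ℝ) = z
  generalize Qf ((5 / 2 / r) ^ 2) = w
  field_simp
  ring

/-! The rational bounds. -/
def dm : ℚ := 12803 / 5000
def dp : ℚ := 25607 / 10000
def Cm : ℚ := 73 / 25
def Cp : ℚ := 2923 / 1000

def hLo : ℚ := lsum (El dp dm Cm)
def hHi : ℚ := lsum (El dm dp Cp)

def lowVal : ℚ :=
  (lval (2 * dp - 2) (T1l dm Cm) - lval (2 * dp - 2 + 2 * dm) (lmul (T1l dm Cm) (El dm dp Cp)))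
  + (lval (4 * dp - 2) (T4l Cm) - lval (4 * dp - 2 + 2 * dm) (lmul (T4l Cm) (El dm dp Cp)))
  - (lval (2 * dm - 2) (T2l Cp)
      - 3 / 4 * lval (2 * dm - 2 + 2 * dp) (lmul (T2l Cp) (El dp dm Cm)))
  - (lval (3 * dm - 2) (T3l Cp)
      - 3 / 4 * lval (3 * dm - 2 + 2 * dp) (lmul (T3l Cp) (El dp dm Cm)))

def highVal : ℚ :=
  (lval (2 * dm - 2) (T1l dp Cp)
      - 3 / 4 * lval (2 * dm - 2 + 2 * dp) (lmul (T1l dp Cp) (El dp dm Cm)))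
  + (lval (4 * dm - 2) (T4l Cp)
      - 3 / 4 * lval (4 * dm - 2 + 2 * dp) (lmul (T4l Cp) (El dp dm Cm)))
  - (lval (2 * dp - 2) (T2l Cm) - lval (2 * dp - 2 + 2 * dm) (lmul (T2l Cm) (El dm dp Cp)))
  - (lval (3 * dp - 2) (T3l Cm) - lval (3 * dp - 2 + 2 * dm) (lmul (T3l Cm) (El dm dp Cp)))

lemma num_h : hHi ≤ 1 / 2 := by decide +kernel
lemma num_low : 12 < 145 / 8 * (1 - hHi) + lowVal := by decide +kernel
lemma num_high : 145 / 8 * (1 - 3 / 4 * hLo) + highVal < 16 := by decide +kernel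

/-! Bounds on `Δ`, the prefactor and `y`. -/
noncomputable def yf (D r : ℝ) : ℝ := (3.8 / r) ^ D

lemma D_bounds : (2.5606 : ℝ) ≤ 3 / 2 + 3 / (2 * Real.sqrt 2) ∧
    3 / 2 + 3 / (2 * Real.sqrt 2) ≤ (2.5607 : ℝ) := by
  have h1 : (1.41421 : ℝ) ≤ Real.sqrt 2 := Real.le_sqrt_of_sq_le (by norm_num)
  have h2 : Real.sqrt 2 ≤ 1.41422 := Real.sqrt_le_iff.2 ⟨by norm_num, by norm_num⟩
  have hp : 0 < 2 * Real.sqrt 2 := by linarith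
  constructor
  · have : 1.0606 ≤ 3 / (2 * Real.sqrt 2) := by rw [le_div_iff₀ hp]; linarith
    linarith
  · have : 3 / (2 * Real.sqrt 2) ≤ 1.0607 := by rw [div_le_iff₀ hp]; linarith
    linarith

lemma C_bounds (D : ℝ) (h1 : 2.5606 ≤ D) (h2 : D ≤ 2.5607) :
    (Cm : ℝ) ≤ (1.52 : ℝ) ^ D ∧ (1.52 : ℝ) ^ D ≤ (Cp : ℝ) := by
  constructor
  · have a : (1.52 : ℝ) ^ (64 / 25 : ℝ) ≤ 1.52 ^ D :=
      Real.rpow_le_rpow_of_exponent_le (by norm_num) (by norm_num at h1 ⊢; linarith)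
    refine le_trans ?_ a
    refine le_of_pow_le_pow_left₀ (n := 25) (by norm_num) (by positivity) ?_
    rw [← Real.rpow_natCast, ← Real.rpow_natCast, ← Real.rpow_mul (by norm_num)]
    norm_num [Cm]
  · have a : (1.52 : ℝ) ^ D ≤ 1.52 ^ (105 / 41 : ℝ) :=
      Real.rpow_le_rpow_of_exponent_le (by norm_num) (by norm_num at h2 ⊢; linarith)
    refine le_trans a ?_
    refine le_of_pow_le_pow_left₀ (n := 41) (by norm_num) (by norm_num [Cp]) ?_
    rw [← Real.rpow_natCast, ← Real.rpow_natCast, ← Real.rpow_mul (by norm_num)]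
    norm_num [Cp]

lemma y_bounds (D : ℝ) (h1 : 2.5606 ≤ D) (h2 : D ≤ 2.5607) {r : ℝ} (hr : 5 / 2 < r) :
    (Cm : ℝ) * (5 / 2 / r) ^ (dp : ℝ) ≤ yf D r ∧
    yf D r ≤ (Cp : ℝ) * (5 / 2 / r) ^ (dm : ℝ) := by
  have hr0 : 0 < r := by linarith
  have ht : 0 < 5 / 2 / r := by positivity
  have ht1 : 5 / 2 / r ≤ 1 := by rw [div_le_one hr0]; exact hr.le
  have e : yf D r = 1.52 ^ D * (5 / 2 / r) ^ D := by
    rw [yf, ← Real.mul_rpow (by norm_num) ht.le]; congr 1; ring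
  obtain ⟨c1, c2⟩ := C_bounds D h1 h2
  have m1 : (5 / 2 / r) ^ (dp : ℝ) ≤ (5 / 2 / r) ^ D :=
    Real.rpow_le_rpow_of_exponent_ge ht ht1 (by norm_num [dp] at h2 ⊢; linarith)
  have m2 : (5 / 2 / r) ^ D ≤ (5 / 2 / r) ^ (dm : ℝ) :=
    Real.rpow_le_rpow_of_exponent_ge ht ht1 (by norm_num [dm] at h1 ⊢; linarith)
  rw [e]
  constructor
  · exact mul_le_mul c1 m1 (by positivity) (by positivity)
  · exact mul_le_mul c2 m2 (by positivity) (by norm_num [Cp])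

lemma Kf_mono {y y' e e' r : ℝ} (hr : 0 < r) (hy : 0 ≤ y) (hyy : y ≤ y')
    (hp : pf e ((5 / 2 / r) ^ 2) ^ 2 ≤ pf e' ((5 / 2 / r) ^ 2) ^ 2) :
    Kf y e r ≤ Kf y' e' r := by
  unfold Kf
  generalize pf e ((5 / 2 / r) ^ 2) = w at *
  generalize pf e' ((5 / 2 / r) ^ 2) = w' at *
  rw [div_pow (y * w), div_pow (y' * w'), mul_pow, mul_pow]
  gcongr

lemma T1f_mono {y y' e e' r : ℝ} (hr : 0 < r) (hy : 0 ≤ y) (hyy : y ≤ y')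
    (hp : pf e ((5 / 2 / r) ^ 2) ^ 2 ≤ pf e' ((5 / 2 / r) ^ 2) ^ 2) :
    T1f y e r ≤ T1f y' e' r := by
  unfold T1f
  generalize pf e ((5 / 2 / r) ^ 2) = w at *
  generalize pf e' ((5 / 2 / r) ^ 2) = w' at *
  rw [div_pow (y * w), div_pow (y' * w'), mul_pow, mul_pow]
  gcongr

lemma T2f_mono {y y' r : ℝ} (hy : 0 ≤ y) (hyy : y ≤ y') : T2f y r ≤ T2f y' r := by
  have := Qf_pos ((5 / 2 / r) ^ 2)
  unfold T2f; gcongr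

lemma T3f_mono {y y' r : ℝ} (hy : 0 ≤ y) (hyy : y ≤ y') : T3f y r ≤ T3f y' r := by
  have := Qf_pos ((5 / 2 / r) ^ 2)
  unfold T3f; gcongr

lemma T4f_mono {y y' r : ℝ} (hy : 0 ≤ y) (hyy : y ≤ y') : T4f y r ≤ T4f y' r := by
  have := Qf_pos ((5 / 2 / r) ^ 2)
  unfold T4f; gcongr

lemma T_nonneg {y e r : ℝ} (hr : 0 < r) (hy : 0 ≤ y) :
    0 ≤ Kf y e r ∧ 0 ≤ T1f y e r ∧ 0 ≤ T2f y r ∧ 0 ≤ T3f y r ∧ 0 ≤ T4f y r := by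
  have := Qf_pos ((5 / 2 / r) ^ 2)
  unfold Kf T1f T2f T3f T4f
  refine ⟨?_, ?_, ?_, ?_, ?_⟩ <;> positivity

lemma all_bounds (D : ℝ) (h1 : 2.5606 ≤ D) (h2 : D ≤ 2.5607) {r : ℝ} (hr : 5 / 2 < r) :
    (0 ≤ G (2 * dp + 1) (Kl dm Cm) r ∧ G (2 * dp + 1) (Kl dm Cm) r ≤ Kf (yf D r) D r ∧
      Kf (yf D r) D r ≤ G (2 * dm + 1) (Kl dp Cp) r) ∧
    (0 ≤ G (2 * dp - 2) (T1l dm Cm) r ∧ G (2 * dp - 2) (T1l dm Cm) r ≤ T1f (yf D r) D r ∧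
      T1f (yf D r) D r ≤ G (2 * dm - 2) (T1l dp Cp) r) ∧
    (0 ≤ G (2 * dp - 2) (T2l Cm) r ∧ G (2 * dp - 2) (T2l Cm) r ≤ T2f (yf D r) r ∧
      T2f (yf D r) r ≤ G (2 * dm - 2) (T2l Cp) r) ∧
    (0 ≤ G (3 * dp - 2) (T3l Cm) r ∧ G (3 * dp - 2) (T3l Cm) r ≤ T3f (yf D r) r ∧
      T3f (yf D r) r ≤ G (3 * dm - 2) (T3l Cp) r) ∧
    (0 ≤ G (4 * dp - 2) (T4l Cm) r ∧ G (4 * dp - 2) (T4l Cm) r ≤ T4f (yf D r) r ∧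
      T4f (yf D r) r ≤ G (4 * dm - 2) (T4l Cp) r) := by
  have hr0 : 0 < r := by linarith
  have ht : 0 < 5 / 2 / r := by positivity
  obtain ⟨y1, y2⟩ := y_bounds D h1 h2 hr
  obtain ⟨p1, p2⟩ := pf_bounds D ((5 / 2 / r) ^ 2) h1 h2
  have em : ((dm : ℚ) : ℝ) = 2.5606 := by norm_num [dm]
  have ep : ((dp : ℚ) : ℝ) = 2.5607 := by norm_num [dp]
  have y0 : 0 ≤ (Cm : ℝ) * (5 / 2 / r) ^ (dp : ℝ) := by
    have : (0 : ℝ) ≤ Cm := by norm_num [Cm]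
    positivity
  have y0' := y0.trans y1
  rw [← em] at p1
  rw [← ep] at p2
  obtain ⟨n0, n1, n2, n3, n4⟩ := T_nonneg (e := (dm : ℝ)) hr0 y0
  rw [← Kf_eq dp dm Cm hr0, ← Kf_eq dm dp Cp hr0, ← T1f_eq dp dm Cm hr0, ← T1f_eq dm dp Cp hr0,
    ← T2f_eq dp Cm hr0, ← T2f_eq dm Cp hr0, ← T3f_eq dp Cm hr0, ← T3f_eq dm Cp hr0,
    ← T4f_eq dp Cm hr0, ← T4f_eq dm Cp hr0]
  exact ⟨⟨n0, Kf_mono hr0 y0 y1 p1, Kf_mono hr0 y0' y2 p2⟩,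
    ⟨n1, T1f_mono hr0 y0 y1 p1, T1f_mono hr0 y0' y2 p2⟩,
    ⟨n2, T2f_mono y0 y1, T2f_mono y0' y2⟩,
    ⟨n3, T3f_mono y0 y1, T3f_mono y0' y2⟩,
    ⟨n4, T4f_mono y0 y1, T4f_mono y0' y2⟩⟩

/-- The exact exponent density. -/
noncomputable def Kx (D r : ℝ) : ℝ := Kf (yf D r) D r
noncomputable def Ex (D r : ℝ) : ℝ := ∫ s in Ioi r, Kx D s
noncomputable def Tx (D r : ℝ) : ℝ :=
  T1f (yf D r) D r + T4f (yf D r) r - T2f (yf D r) r - T3f (yf D r) r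

lemma yf_cont (D : ℝ) : ContinuousOn (yf D) (Ioi (5 / 2)) := by
  intro r hr
  have hr0 : (0 : ℝ) < r := lt_trans (by norm_num) hr
  apply ContinuousAt.continuousWithinAt
  unfold yf
  refine ContinuousAt.rpow_const ?_ (Or.inl (by positivity))
  exact continuousAt_const.div continuousAt_id hr0.ne'

lemma Kx_cont (D : ℝ) : ContinuousOn (Kx D) (Ioi (5 / 2)) := by
  have h := yf_cont D
  have h0 : ∀ r ∈ Ioi (5 / 2 : ℝ), r ≠ 0 := fun r hr => (lt_trans (by norm_num) hr : (0:ℝ) < r).ne'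
  unfold Kx Kf pf
  fun_prop (disch := assumption)

lemma Tx_cont (D : ℝ) : ContinuousOn (Tx D) (Ioi (5 / 2)) := by
  have h := yf_cont D
  have h0 : ∀ r ∈ Ioi (5 / 2 : ℝ), r ≠ 0 := fun r hr => (lt_trans (by norm_num) hr : (0:ℝ) < r).ne'
  unfold Tx T1f T2f T3f T4f pf Qf
  fun_prop (disch := assumption)

lemma G_intOn (a : ℚ) (ha : 1 < a) (l : List ℚ) : IntegrableOn (G a l) (Ioi (5 / 2)) :=
  (G_int a ha l (by norm_num)).1

lemma Kx_int (D : ℝ) (h1 : 2.5606 ≤ D) (h2 : D ≤ 2.5607) : IntegrableOn (Kx D) (Ioi (5 / 2)) := by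
  refine Integrable.mono' (G_intOn (2 * dm + 1) (by norm_num [dm]) (Kl dp Cp))
    ((Kx_cont D).aestronglyMeasurable measurableSet_Ioi) ?_
  filter_upwards [ae_restrict_mem measurableSet_Ioi] with r hr
  obtain ⟨⟨a, b, c⟩, -⟩ := all_bounds D h1 h2 hr
  rw [Kx, Real.norm_of_nonneg (a.trans b)]
  exact c

lemma G_shift (d : ℚ) (l : List ℚ) {r : ℝ} (hr : 0 < r) :
    r * G (2 * d + 1) l r = G (2 * d) (lsc (5 / 2) l) r := by
  have ht : 0 < 5 / 2 / r := by positivity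
  simp only [G, hor_lsc]
  push_cast
  rw [Real.rpow_add ht, Real.rpow_one]
  field_simp

lemma Ex_bounds (D : ℝ) (h1 : 2.5606 ≤ D) (h2 : D ≤ 2.5607) {r : ℝ} (hr : 5 / 2 ≤ r) :
    G (2 * dp) (El dp dm Cm) r ≤ Ex D r ∧ Ex D r ≤ G (2 * dm) (El dm dp Cp) r := by
  have hr0 : 0 < r := by linarith
  have hK := (Kx_int D h1 h2).mono_set (Ioi_subset_Ioi hr)
  obtain ⟨i1, j1⟩ := G_int (2 * dp + 1) (by norm_num [dp]) (Kl dm Cm) hr0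
  obtain ⟨i2, j2⟩ := G_int (2 * dm + 1) (by norm_num [dm]) (Kl dp Cp) hr0
  rw [El, El, ← G_shift _ _ hr0, ← G_shift _ _ hr0, ← j1, ← j2]
  constructor
  · exact setIntegral_mono_on i1 hK measurableSet_Ioi
      fun s hs => (all_bounds D h1 h2 (lt_of_le_of_lt hr hs)).1.2.1
  · exact setIntegral_mono_on hK i2 measurableSet_Ioi
      fun s hs => (all_bounds D h1 h2 (lt_of_le_of_lt hr hs)).1.2.2

lemma Ex_anti (D : ℝ) (h1 : 2.5606 ≤ D) (h2 : D ≤ 2.5607) : AntitoneOn (Ex D) (Ici (5 / 2)) := by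
  intro r hr s hs hrs
  have hK := (Kx_int D h1 h2).mono_set (Ioi_subset_Ioi hr)
  refine setIntegral_mono_set hK ?_ (Ioi_subset_Ioi hrs).eventuallyLE
  filter_upwards [ae_restrict_mem measurableSet_Ioi] with x hx
  obtain ⟨⟨a, b, c⟩, -⟩ := all_bounds D h1 h2 (lt_of_le_of_lt hr hx)
  exact a.trans b

lemma G_at (a : ℚ) (l : List ℚ) : G a l (5 / 2) = (lsum l : ℝ) := by
  rw [G, div_self (by norm_num)]; simp [hor_one]

lemma h_bounds (D : ℝ) (h1 : 2.5606 ≤ D) (h2 : D ≤ 2.5607) :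
    (hLo : ℝ) ≤ Ex D (5 / 2) ∧ Ex D (5 / 2) ≤ (hHi : ℝ) := by
  have := Ex_bounds D h1 h2 (le_refl _)
  rwa [G_at, G_at] at this

lemma Ex_range (D : ℝ) (h1 : 2.5606 ≤ D) (h2 : D ≤ 2.5607) {r : ℝ} (hr : 5 / 2 ≤ r) :
    0 ≤ Ex D r ∧ Ex D r ≤ 1 / 2 := by
  constructor
  · refine setIntegral_nonneg measurableSet_Ioi fun x hx => ?_
    obtain ⟨⟨a, b, c⟩, -⟩ := all_bounds D h1 h2 (lt_of_le_of_lt hr hx)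
    exact a.trans b
  · refine (Ex_anti D h1 h2 self_mem_Ici hr hr).trans ((h_bounds D h1 h2).2.trans ?_)
    have : ((hHi : ℚ) : ℝ) ≤ ((1 / 2 : ℚ) : ℝ) := by exact_mod_cast num_h
    simpa using this

lemma exp_bounds {x : ℝ} (h0 : 0 ≤ x) (h1 : x ≤ 1 / 2) :
    1 - x ≤ Real.exp (-x) ∧ Real.exp (-x) ≤ 1 - 3 / 4 * x := by
  constructor
  · have := Real.add_one_le_exp (-x); linarith
  · have h := Real.quadratic_le_exp_of_nonneg h0
    have hp := Real.exp_pos x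
    rw [Real.exp_neg, inv_le_iff_one_le_mul₀ hp]
    have : (1 - 3 / 4 * x) * (1 + x + x ^ 2 / 2) ≤ (1 - 3 / 4 * x) * Real.exp x :=
      mul_le_mul_of_nonneg_left h (by linarith)
    nlinarith [mul_nonneg h0 h0, mul_nonneg h0 (sub_nonneg.2 h1)]

noncomputable def Fx (D r : ℝ) : ℝ := Real.exp (-Ex D r) * Tx D r

lemma Fx_int (D : ℝ) (h1 : 2.5606 ≤ D) (h2 : D ≤ 2.5607) : IntegrableOn (Fx D) (Ioi (5 / 2)) := by
  have i1 := G_intOn (2 * dm - 2) (by norm_num [dm]) (T1l dp Cp)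
  have i2 := G_intOn (2 * dm - 2) (by norm_num [dm]) (T2l Cp)
  have i3 := G_intOn (3 * dm - 2) (by norm_num [dm]) (T3l Cp)
  have i4 := G_intOn (4 * dm - 2) (by norm_num [dm]) (T4l Cp)
  refine Integrable.mono' (((i1.add i4).add i2).add i3) ?_ ?_
  · refine AEStronglyMeasurable.mul ?_ ((Tx_cont D).aestronglyMeasurable measurableSet_Ioi)
    have : AEMeasurable (Ex D) (volume.restrict (Ioi (5 / 2))) :=
      aemeasurable_restrict_of_antitoneOn measurableSet_Ioi
        ((Ex_anti D h1 h2).mono Ioi_subset_Ici_self)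
    exact (Real.measurable_exp.comp_aemeasurable this.neg).aestronglyMeasurable
  · filter_upwards [ae_restrict_mem measurableSet_Ioi] with r hr
    obtain ⟨-, ⟨a1, b1, c1⟩, ⟨a2, b2, c2⟩, ⟨a3, b3, c3⟩, ⟨a4, b4, c4⟩⟩ := all_bounds D h1 h2 hr
    have hE := (Ex_range D h1 h2 (le_of_lt hr)).1
    have he : Real.exp (-Ex D r) ≤ 1 := Real.exp_le_one_iff.2 (by linarith)
    have hep := Real.exp_pos (-Ex D r)
    simp only [Pi.add_apply]
    rw [Fx, norm_mul, Real.norm_of_nonneg hep.le]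
    have ht : ‖Tx D r‖ ≤ G (2 * dm - 2) (T1l dp Cp) r + G (4 * dm - 2) (T4l Cp) r
        + G (2 * dm - 2) (T2l Cp) r + G (3 * dm - 2) (T3l Cp) r := by
      rw [Real.norm_eq_abs, abs_le, Tx]
      constructor <;> linarith
    nlinarith [norm_nonneg (Tx D r)]

/-- product of a building block with the linear lower/upper factor -/
lemma prod_val (a b : ℚ) (ha : 1 < a) (hb : 0 ≤ b) (l m : List ℚ) (k : ℝ) :
    IntegrableOn (fun r => G a l r * (1 - k * G b m r)) (Ioi (5 / 2)) ∧
    ∫ r in Ioi (5 / 2 : ℝ), G a l r * (1 - k * G b m r)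
      = (lval a l : ℝ) - k * (lval (a + b) (lmul l m) : ℝ) := by
  have key : ∀ r ∈ Ioi (5 / 2 : ℝ), G a l r * (1 - k * G b m r)
      = G a l r - k * G (a + b) (lmul l m) r := by
    intro r hr
    rw [← G_mul a b l m (lt_trans (by norm_num) hr)]; ring
  have i1 := G_intOn a ha l
  have i2 := (G_intOn (a + b) (by linarith) (lmul l m)).const_mul k
  constructor
  · rw [integrableOn_congr_fun key measurableSet_Ioi]
    exact i1.sub i2
  · rw [setIntegral_congr_fun measurableSet_Ioi key, integral_sub i1 i2, integral_const_mul,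
      G_val a ha, G_val (a + b) (by linarith)]

lemma up_mul {T T' e E E' k : ℝ} (h0 : 0 ≤ T) (hT : T ≤ T') (he : e ≤ 1 - k * E) (hk : 0 ≤ k)
    (hE : E' ≤ E) (h1 : k * E ≤ 1) : e * T ≤ T' * (1 - k * E') := by
  have h2 : k * E' ≤ k * E := mul_le_mul_of_nonneg_left hE hk
  calc e * T ≤ (1 - k * E) * T := mul_le_mul_of_nonneg_right he h0
    _ ≤ (1 - k * E) * T' := mul_le_mul_of_nonneg_left hT (by linarith)
    _ ≤ (1 - k * E') * T' := mul_le_mul_of_nonneg_right (by linarith) (h0.trans hT)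
    _ = _ := mul_comm _ _

lemma lo_mul {T T' e E E' : ℝ} (h0 : 0 ≤ T') (hT : T' ≤ T) (he : 1 - E ≤ e)
    (hE : E ≤ E') (h1 : E ≤ 1) : T' * (1 - 1 * E') ≤ e * T := by
  calc T' * (1 - 1 * E') ≤ T' * (1 - E) := mul_le_mul_of_nonneg_left (by linarith) h0
    _ ≤ T * (1 - E) := mul_le_mul_of_nonneg_right hT (by linarith)
    _ ≤ T * e := mul_le_mul_of_nonneg_left he (h0.trans hT)
    _ = _ := mul_comm _ _

lemma int4 {f g h k : ℝ → ℝ} {s : Set ℝ} (hf : IntegrableOn f s) (hg : IntegrableOn g s)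
    (hh : IntegrableOn h s) (hk : IntegrableOn k s) :
    ∫ r in s, (f r + g r - h r - k r)
      = (∫ r in s, f r) + (∫ r in s, g r) - (∫ r in s, h r) - ∫ r in s, k r := by
  have a : IntegrableOn (fun r => f r + g r) s := hf.add hg
  have b : IntegrableOn (fun r => f r + g r - h r) s := a.sub hh
  rw [integral_sub b hk, integral_sub a hh, integral_add hf hg]

lemma Fx_low (D : ℝ) (h1 : 2.5606 ≤ D) (h2 : D ≤ 2.5607) :
    (lowVal : ℝ) ≤ ∫ r in Ioi (5 / 2 : ℝ), Fx D r := by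
  obtain ⟨i1, v1⟩ := prod_val (2 * dp - 2) (2 * dm) (by norm_num [dp]) (by norm_num [dm])
    (T1l dm Cm) (El dm dp Cp) 1
  obtain ⟨i4, v4⟩ := prod_val (4 * dp - 2) (2 * dm) (by norm_num [dp]) (by norm_num [dm])
    (T4l Cm) (El dm dp Cp) 1
  obtain ⟨i2, v2⟩ := prod_val (2 * dm - 2) (2 * dp) (by norm_num [dm]) (by norm_num [dp])
    (T2l Cp) (El dp dm Cm) (3 / 4)
  obtain ⟨i3, v3⟩ := prod_val (3 * dm - 2) (2 * dp) (by norm_num [dm]) (by norm_num [dp])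
    (T3l Cp) (El dp dm Cm) (3 / 4)
  have hv : (lowVal : ℝ) = ∫ r in Ioi (5 / 2 : ℝ),
      (G (2 * dp - 2) (T1l dm Cm) r * (1 - 1 * G (2 * dm) (El dm dp Cp) r)
      + G (4 * dp - 2) (T4l Cm) r * (1 - 1 * G (2 * dm) (El dm dp Cp) r)
      - G (2 * dm - 2) (T2l Cp) r * (1 - 3 / 4 * G (2 * dp) (El dp dm Cm) r)
      - G (3 * dm - 2) (T3l Cp) r * (1 - 3 / 4 * G (2 * dp) (El dp dm Cm) r)) := by
    rw [int4 i1 i4 i2 i3, v1, v2, v3, v4, lowVal]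
    push_cast
    ring
  rw [hv]
  refine setIntegral_mono_on (((i1.add i4).sub i2).sub i3) (Fx_int D h1 h2) measurableSet_Ioi ?_
  intro r hr
  obtain ⟨-, ⟨a1, b1, c1⟩, ⟨a2, b2, c2⟩, ⟨a3, b3, c3⟩, ⟨a4, b4, c4⟩⟩ := all_bounds D h1 h2 hr
  obtain ⟨e0, e1⟩ := Ex_range D h1 h2 (le_of_lt hr)
  obtain ⟨l1, l2⟩ := Ex_bounds D h1 h2 (le_of_lt hr)
  obtain ⟨x1, x2⟩ := exp_bounds e0 e1
  have q1 := lo_mul a1 b1 x1 l2 (by linarith)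
  have q4 := lo_mul a4 b4 x1 l2 (by linarith)
  have q2 := up_mul (a2.trans b2) c2 x2 (by norm_num) l1 (by linarith)
  have q3 := up_mul (a3.trans b3) c3 x2 (by norm_num) l1 (by linarith)
  rw [Fx, Tx]
  linarith

lemma Fx_high (D : ℝ) (h1 : 2.5606 ≤ D) (h2 : D ≤ 2.5607) :
    ∫ r in Ioi (5 / 2 : ℝ), Fx D r ≤ (highVal : ℝ) := by
  obtain ⟨i1, v1⟩ := prod_val (2 * dm - 2) (2 * dp) (by norm_num [dm]) (by norm_num [dp])
    (T1l dp Cp) (El dp dm Cm) (3 / 4)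
  obtain ⟨i4, v4⟩ := prod_val (4 * dm - 2) (2 * dp) (by norm_num [dm]) (by norm_num [dp])
    (T4l Cp) (El dp dm Cm) (3 / 4)
  obtain ⟨i2, v2⟩ := prod_val (2 * dp - 2) (2 * dm) (by norm_num [dp]) (by norm_num [dm])
    (T2l Cm) (El dm dp Cp) 1
  obtain ⟨i3, v3⟩ := prod_val (3 * dp - 2) (2 * dm) (by norm_num [dp]) (by norm_num [dm])
    (T3l Cm) (El dm dp Cp) 1
  have hv : (highVal : ℝ) = ∫ r in Ioi (5 / 2 : ℝ),
      (G (2 * dm - 2) (T1l dp Cp) r * (1 - 3 / 4 * G (2 * dp) (El dp dm Cm) r)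
      + G (4 * dm - 2) (T4l Cp) r * (1 - 3 / 4 * G (2 * dp) (El dp dm Cm) r)
      - G (2 * dp - 2) (T2l Cm) r * (1 - 1 * G (2 * dm) (El dm dp Cp) r)
      - G (3 * dp - 2) (T3l Cm) r * (1 - 1 * G (2 * dm) (El dm dp Cp) r)) := by
    rw [int4 i1 i4 i2 i3, v1, v2, v3, v4, highVal]
    push_cast
    ring
  rw [hv]
  refine setIntegral_mono_on (Fx_int D h1 h2) (((i1.add i4).sub i2).sub i3) measurableSet_Ioi ?_
  intro r hr
  obtain ⟨-, ⟨a1, b1, c1⟩, ⟨a2, b2, c2⟩, ⟨a3, b3, c3⟩, ⟨a4, b4, c4⟩⟩ := all_bounds D h1 h2 hr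
  obtain ⟨e0, e1⟩ := Ex_range D h1 h2 (le_of_lt hr)
  obtain ⟨l1, l2⟩ := Ex_bounds D h1 h2 (le_of_lt hr)
  obtain ⟨x1, x2⟩ := exp_bounds e0 e1
  have q2 := lo_mul a2 b2 x1 l2 (by linarith)
  have q3 := lo_mul a3 b3 x1 l2 (by linarith)
  have q1 := up_mul (a1.trans b1) c1 x2 (by norm_num) l1 (by linarith)
  have q4 := up_mul (a4.trans b4) c4 x2 (by norm_num) l1 (by linarith)
  rw [Fx, Tx]
  linarith

lemma phi_deriv (D : ℝ) (φ : ℝ → ℝ)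
    (hφ : ∀ r ≥ (5 / 2 : ℝ), φ r = (3.8 / r) ^ D * (-1 + (3.2 / r) ^ 2 - (2.4 / r) ^ 4))
    {r : ℝ} (hr : 5 / 2 < r) :
    φ r = -(yf D r * Qf ((5 / 2 / r) ^ 2)) ∧
    deriv φ r = -(yf D r * pf D ((5 / 2 / r) ^ 2) / r) := by
  have hr0 : 0 < r := by linarith
  constructor
  · rw [hφ r hr.le, yf, Qf]; field_simp; norm_num; ring
  · have ev : φ =ᶠ[nhds r] fun r => (3.8 / r) ^ D * (-1 + (3.2 / r) ^ 2 - (2.4 / r) ^ 4) := by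
      filter_upwards [lt_mem_nhds hr] with s hs using hφ s (le_of_lt hs)
    rw [ev.deriv_eq]
    have hd : ∀ c : ℝ, HasDerivAt (fun r : ℝ => c / r) (-c / r ^ 2) r := by
      intro c
      have := (hasDerivAt_inv hr0.ne').const_mul c
      simpa [div_eq_mul_inv] using this
    have hpos : (0 : ℝ) < 3.8 / r := by positivity
    have k1 := (hd 3.8).rpow_const (p := D) (Or.inl hpos.ne')
    have k2 := (((hd 3.2).pow 2).const_add (-1)).sub ((hd 2.4).pow 4)
    have k3 := k1.mul k2
    refine (HasDerivAt.deriv (f := fun r : ℝ => (3.8 / r) ^ D * (-1 + (3.2 / r) ^ 2 - (2.4 / r) ^ 4)) k3).trans ?_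
    rw [Real.rpow_sub hpos, Real.rpow_one, yf, pf]
    generalize (3.8 / r) ^ D = z
    simp only [Pi.pow_apply, Pi.sub_apply]
    norm_num
    field_simp
    ring

end MassEst

open MassEst MeasureTheory Set
theorem explicit_dataset_mass_estimate
    (r₀ Δ ω₀ : ℝ) (hr₀ : r₀ = 2.5)
    (hΔ : Δ = 3 / 2 + 3 / (2 * Real.sqrt 2))
    (hω₀ : ω₀ = r₀ + r₀ ^ 3)
    (V φ h χ ω : ℝ → ℝ)
    (hV : ∀ x, V x = -(9 / 16) * x ^ 2 + 9 * x ^ 3 + 11 * x ^ 4)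
    (hφ : ∀ r ≥ r₀, φ r = (3.8 / r) ^ Δ * (-1 + (3.2 / r) ^ 2 - (2.4 / r) ^ 4))
    (hh : ∀ r, h r = (1 / 2) * ∫ ρ in r₀..r, ρ * deriv φ ρ ^ 2)
    (hχ : ∀ r, χ r = (1 + r ^ 2) * deriv φ r ^ 2 + 2 * V (φ r))
    (hω : ∀ r, ω r = Real.exp (-h r) *
      (ω₀ + (1 / 2) * ∫ ρ in r₀..r, Real.exp (h ρ) * ρ ^ 2 * χ ρ)) :
    ∃ ωinf : ℝ, Tendsto ω atTop (nhds ωinf) ∧ 12 < ωinf ∧ ωinf < 16 := by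
  have hr0' : r₀ = 5 / 2 := by rw [hr₀]; norm_num
  clear hr₀
  subst hr0'
  obtain ⟨h1, h2⟩ := D_bounds
  rw [← hΔ] at h1 h2
  have hK := Kx_int Δ h1 h2
  have hF := Fx_int Δ h1 h2
  have hw0 : ω₀ = 145 / 8 := by rw [hω₀]; norm_num
  -- `h` in terms of `Kx`
  have hhK : ∀ r ≥ (5 / 2 : ℝ), h r = ∫ s in (5 / 2 : ℝ)..r, Kx Δ s := by
    intro r hr
    rw [hh, ← intervalIntegral.integral_const_mul]
    rw [intervalIntegral.integral_of_le hr, intervalIntegral.integral_of_le hr]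
    refine setIntegral_congr_fun measurableSet_Ioc fun s hs => ?_
    simp only [(phi_deriv Δ φ hφ hs.1).2, Kx, Kf, neg_sq]
  have hhE : ∀ r ≥ (5 / 2 : ℝ), h r = Ex Δ (5 / 2) - Ex Δ r := by
    intro r hr
    have hu : Ioi (5 / 2 : ℝ) = Ioc (5 / 2) r ∪ Ioi r := (Ioc_union_Ioi_eq_Ioi hr).symm
    have := setIntegral_union (μ := volume) (f := Kx Δ) (Ioc_disjoint_Ioi (a := (5 / 2 : ℝ)) (le_refl r))
      measurableSet_Ioi (hK.mono_set Ioc_subset_Ioi_self) (hK.mono_set (Ioi_subset_Ioi hr))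
    rw [← hu] at this
    rw [hhK r hr, intervalIntegral.integral_of_le hr, Ex, Ex, this]
    ring
  have hχF : ∀ r ≥ (5 / 2 : ℝ), (1 / 2) * ∫ ρ in (5 / 2 : ℝ)..r, Real.exp (h ρ) * ρ ^ 2 * χ ρ
      = Real.exp (Ex Δ (5 / 2)) * ∫ ρ in (5 / 2 : ℝ)..r, Fx Δ ρ := by
    intro r hr
    rw [← intervalIntegral.integral_const_mul, ← intervalIntegral.integral_const_mul]
    rw [intervalIntegral.integral_of_le hr, intervalIntegral.integral_of_le hr]
    refine setIntegral_congr_fun measurableSet_Ioc fun s hs => ?_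
    obtain ⟨d1, d2⟩ := phi_deriv Δ φ hφ hs.1
    have hs0 : s ≠ 0 := (lt_trans (by norm_num) hs.1 : (0 : ℝ) < s).ne'
    simp only [hhE s hs.1.le, hχ, hV, d1, d2, Fx, Tx, T1f, T2f, T3f, T4f, sub_eq_add_neg,
      Real.exp_add]
    ring
  have tK : Tendsto h atTop (nhds (Ex Δ (5 / 2))) := by
    have := intervalIntegral_tendsto_integral_Ioi (5 / 2 : ℝ) hK tendsto_id
    refine this.congr' ?_
    filter_upwards [eventually_ge_atTop (5 / 2 : ℝ)] with r hr
    exact (hhK r hr).symm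
  have tF := intervalIntegral_tendsto_integral_Ioi (5 / 2 : ℝ) hF tendsto_id
  refine ⟨Real.exp (-Ex Δ (5 / 2)) * (ω₀ + Real.exp (Ex Δ (5 / 2)) * ∫ r in Ioi (5 / 2 : ℝ), Fx Δ r),
    ?_, ?_⟩
  · have := ((Real.continuous_exp.tendsto _).comp tK.neg).mul ((tF.const_mul
      (Real.exp (Ex Δ (5 / 2)))).const_add ω₀)
    refine this.congr' ?_
    filter_upwards [eventually_ge_atTop (5 / 2 : ℝ)] with r hr
    rw [hω, hχF r hr]
    rfl
  · have e : Real.exp (-Ex Δ (5 / 2)) * (ω₀ + Real.exp (Ex Δ (5 / 2))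
        * ∫ r in Ioi (5 / 2 : ℝ), Fx Δ r)
        = 145 / 8 * Real.exp (-Ex Δ (5 / 2)) + ∫ r in Ioi (5 / 2 : ℝ), Fx Δ r := by
      rw [mul_add, ← mul_assoc, ← Real.exp_add, hw0]; simp; ring
    rw [e]
    obtain ⟨e0, e1⟩ := Ex_range Δ h1 h2 (le_refl _)
    obtain ⟨x1, x2⟩ := exp_bounds e0 e1
    obtain ⟨b1, b2⟩ := h_bounds Δ h1 h2
    have fl := Fx_low Δ h1 h2
    have fh := Fx_high Δ h1 h2
    have n1 : ((12 : ℚ) : ℝ) < ((145 / 8 * (1 - hHi) + lowVal : ℚ) : ℝ) := by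
      exact_mod_cast num_low
    have n2 : ((145 / 8 * (1 - 3 / 4 * hLo) + highVal : ℚ) : ℝ) < ((16 : ℚ) : ℝ) := by
      exact_mod_cast num_high
    push_cast at n1 n2
    constructor <;> linarith
end
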